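/- arXiv:1309.7123 — 2 statements merged into one kernel-verified Lean document; each statement's English description precedes it below -/
import Mathlib

section
/- Let k, d ≥ 1, let g : ℝ^k × ℝ^{k×d} → ℝ^k, and let v ≥ 0, a > 0, ψ ≥ 0, r' > 0, C ≥ 0 be real numbers and V ∈ ℝ^{k×d}. Assume: (i) ⟨y₁ − y₂, g(y₁, z) − g(y₂, z)⟩ ≤ 0 for all y₁, y₂ ∈ ℝ^k and z ∈ ℝ^{k×d}; (ii) ‖g(y, z₁) − g(y, z₂)‖ ≤ v‖z₁ − z₂‖ for all y, z₁, z₂; (iii) ‖g(y, 0) − g(0, 0)‖ ≤ ψ for all y with ‖y‖ ≤ r' + 1; and (iv) θ : ℝ^k → [0, 1] satisfies |θ(y) − θ(y')| ≤ C‖y − y'‖ for all y, y' and θ(y) = 0 whenever ‖y‖ ≥ r' + 1. Define h(y) := (a / max(ψ, a)) · θ(y) · (g(y, π_a(V)) − g(0, π_a(V))) + g(0, V). Then for all y₁, y₂ ∈ ℝ^k, ⟨y₁ − y₂, h(y₁) − h(y₂)⟩ ≤ C(2v + 1) a ‖y₁ − y₂‖². -/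
open scoped RealInnerProductSpace

/-- Radial truncation `π_a(x) := (a / max(a, ‖x‖)) • x`. -/
noncomputable def radialTrunc {E : Type*} [NormedAddCommGroup E] [NormedSpace ℝ E]
    (a : ℝ) (x : E) : E := (a / max a ‖x‖) • x

theorem truncated_generator_almost_monotone (k d : ℕ) (hk : 1 ≤ k) (hd : 1 ≤ d)
    (g : EuclideanSpace ℝ (Fin k) → EuclideanSpace ℝ (Fin k × Fin d) → EuclideanSpace ℝ (Fin k))
    (v a ψ r' C : ℝ) (hv : 0 ≤ v) (ha : 0 < a) (hψ : 0 ≤ ψ) (hr' : 0 < r') (hC : 0 ≤ C)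
    (V : EuclideanSpace ℝ (Fin k × Fin d))
    (hmono : ∀ (y₁ y₂ : EuclideanSpace ℝ (Fin k)) (z : EuclideanSpace ℝ (Fin k × Fin d)),
      ⟪y₁ - y₂, g y₁ z - g y₂ z⟫ ≤ 0)
    (hlip : ∀ (y : EuclideanSpace ℝ (Fin k)) (z₁ z₂ : EuclideanSpace ℝ (Fin k × Fin d)),
      ‖g y z₁ - g y z₂‖ ≤ v * ‖z₁ - z₂‖)
    (hgrow : ∀ y : EuclideanSpace ℝ (Fin k), ‖y‖ ≤ r' + 1 → ‖g y 0 - g 0 0‖ ≤ ψ)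
    (θ : EuclideanSpace ℝ (Fin k) → ℝ)
    (hθ01 : ∀ y, θ y ∈ Set.Icc (0 : ℝ) 1)
    (hθlip : ∀ y y', |θ y - θ y'| ≤ C * ‖y - y'‖)
    (hθ0 : ∀ y : EuclideanSpace ℝ (Fin k), r' + 1 ≤ ‖y‖ → θ y = 0)
    (h : EuclideanSpace ℝ (Fin k) → EuclideanSpace ℝ (Fin k))
    (hh : ∀ y, h y = (a / max ψ a) • (θ y • (g y (radialTrunc a V) - g 0 (radialTrunc a V)))
      + g 0 V) :
    ∀ y₁ y₂ : EuclideanSpace ℝ (Fin k),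
      ⟪y₁ - y₂, h y₁ - h y₂⟫ ≤ C * (2 * v + 1) * a * ‖y₁ - y₂‖ ^ 2 := by
  have hm : 0 < max ψ a := lt_max_of_lt_right ha
  have hp : ‖radialTrunc a V‖ ≤ a := by
    have hM : 0 < max a ‖V‖ := lt_max_of_lt_left ha
    unfold radialTrunc
    rw [norm_smul, Real.norm_of_nonneg (by positivity), div_mul_eq_mul_div, div_le_iff₀ hM]
    exact mul_le_mul_of_nonneg_left (le_max_right _ _) ha.le
  set p := radialTrunc a V with hpdef
  have hG : ∀ y : EuclideanSpace ℝ (Fin k), ‖y‖ ≤ r' + 1 → ‖g y p - g 0 p‖ ≤ ψ + 2 * v * a := by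
    intro y hy
    have e : g y p - g 0 p = (g y p - g y 0) + (g y 0 - g 0 0) + (g 0 0 - g 0 p) := by abel
    have h1 := hlip y p 0
    have h2 := hlip 0 0 p
    rw [sub_zero] at h1
    rw [zero_sub, norm_neg] at h2
    have h3 := hgrow y hy
    have h4 : v * ‖p‖ ≤ v * a := mul_le_mul_of_nonneg_left hp hv
    have h5 := norm_add₃_le (a := g y p - g y 0) (b := g y 0 - g 0 0) (c := g 0 0 - g 0 p)
    rw [e]
    linarith
  have hfac : a / max ψ a * (ψ + 2 * v * a) ≤ (2 * v + 1) * a := by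
    rw [div_mul_eq_mul_div, div_le_iff₀ hm]
    have h1 : ψ ≤ max ψ a := le_max_left _ _
    have h2 : v * a ≤ v * max ψ a := mul_le_mul_of_nonneg_left (le_max_right _ _) hv
    nlinarith
  have key : ∀ y₁ y₂ : EuclideanSpace ℝ (Fin k), ‖y₁‖ ≤ r' + 1 →
      ⟪y₁ - y₂, h y₁ - h y₂⟫ ≤ C * (2 * v + 1) * a * ‖y₁ - y₂‖ ^ 2 := by
    intro y₁ y₂ hy
    have e : h y₁ - h y₂ = (a / max ψ a) • (θ y₂ • (g y₁ p - g y₂ p)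
        + (θ y₁ - θ y₂) • (g y₁ p - g 0 p)) := by
      rw [hh, hh]; module
    rw [e, inner_smul_right, inner_add_right, inner_smul_right, inner_smul_right]
    have h1 : θ y₂ * ⟪y₁ - y₂, g y₁ p - g y₂ p⟫ ≤ 0 :=
      mul_nonpos_of_nonneg_of_nonpos (hθ01 y₂).1 (hmono _ _ _)
    have h2 : (θ y₁ - θ y₂) * ⟪y₁ - y₂, g y₁ p - g 0 p⟫
        ≤ (C * ‖y₁ - y₂‖) * (‖y₁ - y₂‖ * (ψ + 2 * v * a)) := by
      refine (le_abs_self _).trans ?_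
      rw [abs_mul]
      refine mul_le_mul (hθlip _ _) ((abs_real_inner_le_norm _ _).trans ?_) (abs_nonneg _)
        (by positivity)
      exact mul_le_mul_of_nonneg_left (hG _ hy) (norm_nonneg _)
    have h3 : 0 ≤ a / max ψ a := by positivity
    calc _ ≤ a / max ψ a * ((C * ‖y₁ - y₂‖) * (‖y₁ - y₂‖ * (ψ + 2 * v * a))) :=
          mul_le_mul_of_nonneg_left (by linarith) h3
      _ = (C * ‖y₁ - y₂‖ ^ 2) * (a / max ψ a * (ψ + 2 * v * a)) := by ring
      _ ≤ (C * ‖y₁ - y₂‖ ^ 2) * ((2 * v + 1) * a) :=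
          mul_le_mul_of_nonneg_left hfac (by positivity)
      _ = _ := by ring
  intro y₁ y₂
  rcases le_total ‖y₁‖ (r' + 1) with h1 | h1
  · exact key _ _ h1
  rcases le_total ‖y₂‖ (r' + 1) with h2 | h2
  · have := key y₂ y₁ h2
    rwa [← neg_sub y₁ y₂, ← neg_sub (h y₁), inner_neg_neg, norm_neg] at this
  · rw [hh, hh, hθ0 _ h1, hθ0 _ h2]
    simp only [zero_smul, smul_zero, sub_self, inner_zero_right]
    positivity
end

section
/- Let k, d ≥ 1, let g : ℝ^k × ℝ^{k×d} → ℝ^k, and let v ≥ 0, a > 0, ψ ≥ 0, r' > 0 be real numbers and V ∈ ℝ^{k×d}. Assume: (i) ⟨y₁ − y₂, g(y₁, z) − g(y₂, z)⟩ ≤ 0 for all y₁, y₂ ∈ ℝ^k and z ∈ ℝ^{k×d}; (ii) ‖g(y, z₁) − g(y, z₂)‖ ≤ v‖z₁ − z₂‖ for all y, z₁, z₂; (iii) ‖g(y, 0) − g(0, 0)‖ ≤ ψ for all y with ‖y‖ ≤ r' + 1; and (iv) θ : ℝ^k → [0, 1] satisfies θ(y) = 0 whenever ‖y‖ ≥ r'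 + 1. Define h(y) := (a / max(ψ, a)) · θ(y) · (g(y, π_a(V)) − g(0, π_a(V))) + g(0, V). Then h(0) = g(0, V); for all y ∈ ℝ^k, ‖h(y)‖ ≤ ‖g(0, V)‖ + (2v + 1)a; and for all y ∈ ℝ^k, ⟨y, h(y)⟩ ≤ ‖y‖ · ‖g(0, V)‖. -/
open scoped RealInnerProductSpace

theorem truncated_generator_bounds (k d : ℕ) (hk : 1 ≤ k) (hd : 1 ≤ d)
    (g : EuclideanSpace ℝ (Fin k) → EuclideanSpace ℝ (Fin k × Fin d) → EuclideanSpace ℝ (Fin k))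
    (v a ψ r' : ℝ) (hv : 0 ≤ v) (ha : 0 < a) (hψ : 0 ≤ ψ) (hr' : 0 < r')
    (V : EuclideanSpace ℝ (Fin k × Fin d))
    (hmono : ∀ (y₁ y₂ : EuclideanSpace ℝ (Fin k)) (z : EuclideanSpace ℝ (Fin k × Fin d)),
      ⟪y₁ - y₂, g y₁ z - g y₂ z⟫ ≤ 0)
    (hlip : ∀ (y : EuclideanSpace ℝ (Fin k)) (z₁ z₂ : EuclideanSpace ℝ (Fin k × Fin d)),
      ‖g y z₁ - g y z₂‖ ≤ v * ‖z₁ - z₂‖)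
    (hgrow : ∀ y : EuclideanSpace ℝ (Fin k), ‖y‖ ≤ r' + 1 → ‖g y 0 - g 0 0‖ ≤ ψ)
    (θ : EuclideanSpace ℝ (Fin k) → ℝ)
    (hθ01 : ∀ y, θ y ∈ Set.Icc (0 : ℝ) 1)
    (hθ0 : ∀ y : EuclideanSpace ℝ (Fin k), r' + 1 ≤ ‖y‖ → θ y = 0)
    (h : EuclideanSpace ℝ (Fin k) → EuclideanSpace ℝ (Fin k))
    (hh : ∀ y, h y = (a / max ψ a) • (θ y • (g y (radialTrunc a V) - g 0 (radialTrunc a V)))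
      + g 0 V) :
    h 0 = g 0 V ∧
    (∀ y : EuclideanSpace ℝ (Fin k), ‖h y‖ ≤ ‖g 0 V‖ + (2 * v + 1) * a) ∧
    (∀ y : EuclideanSpace ℝ (Fin k), ⟪y, h y⟫ ≤ ‖y‖ * ‖g 0 V‖) := by
  have hM : 0 < max ψ a := lt_max_of_lt_right ha
  have hc0 : 0 ≤ a / max ψ a := by positivity
  have hc1 : a / max ψ a ≤ 1 := (div_le_one hM).2 (le_max_right _ _)
  have hcψ : a / max ψ a * ψ ≤ a := by
    rw [div_mul_eq_mul_div, div_le_iff₀ hM]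
    exact mul_le_mul_of_nonneg_left (le_max_left _ _) ha.le
  have hz : ‖radialTrunc a V‖ ≤ a := by
    have hM2 : 0 < max a ‖V‖ := lt_max_of_lt_left ha
    unfold radialTrunc
    rw [norm_smul, Real.norm_of_nonneg (by positivity), div_mul_eq_mul_div, div_le_iff₀ hM2]
    exact mul_le_mul_of_nonneg_left (le_max_right _ _) ha.le
  generalize radialTrunc a V = z at *
  generalize a / max ψ a = c at *
  refine ⟨by simp [hh], fun y => ?_, fun y => ?_⟩
  · obtain ⟨ht0, ht1⟩ := hθ01 y
    have hva : 0 ≤ v * a := by positivity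
    rw [hh, add_comm]
    refine (norm_add_le _ _).trans (add_le_add le_rfl ?_)
    by_cases hy : r' + 1 ≤ ‖y‖
    · rw [hθ0 y hy]
      simp only [zero_smul, smul_zero, norm_zero]
      positivity
    · have h1 := hgrow y (not_le.1 hy).le
      have h2 := hlip y z 0
      have h3 := hlip 0 0 z
      rw [sub_zero] at h2
      rw [zero_sub, norm_neg] at h3
      have h4 : v * ‖z‖ ≤ v * a := mul_le_mul_of_nonneg_left hz hv
      have h5 : ‖g y z - g 0 z‖ ≤ ψ + 2 * (v * a) := by
        have e : g y z - g 0 z = (g y z - g y 0) + (g y 0 - g 0 0) + (g 0 0 - g 0 z) := by abel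
        rw [e]
        refine norm_add₃_le.trans ?_
        linarith
      rw [norm_smul, norm_smul, Real.norm_of_nonneg hc0, Real.norm_of_nonneg ht0]
      have h6 : θ y * ‖g y z - g 0 z‖ ≤ ψ + 2 * (v * a) :=
        (mul_le_of_le_one_left (norm_nonneg _) ht1).trans h5
      have h7 := mul_le_mul_of_nonneg_left h6 hc0
      have h8 : c * (v * a) ≤ v * a := mul_le_of_le_one_left hva hc1
      linarith
  · have h1 := hmono y 0 z
    rw [sub_zero] at h1
    rw [hh, inner_add_right, inner_smul_right, inner_smul_right]
    have h2 := real_inner_le_norm y (g 0 V)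
    have h3 : c * (θ y * ⟪y, g y z - g 0 z⟫) ≤ 0 :=
      mul_nonpos_of_nonneg_of_nonpos hc0 (mul_nonpos_of_nonneg_of_nonpos (hθ01 y).1 h1)
    linarith
end
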